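/- Let F be a field and let a, b, f ∈ F with a not a cube in F, b ≠ 0, and f = g³ for some g ∈ F with g ≠ 0. Suppose there exist u, v, w, t ∈ F, not all zero, such that a·u³ + b·v³ + a·b·w³ + f·t³ = 0. Then b is a norm from the pure cubic extension L = F[X]/(X³ − a): there exists β ∈ L with N_{L/F}(β) = b. -/

import Mathlib

open Polynomial

theorem norm_sub_root_aux (F : Type*) [Field F] (a x : F) :
    Algebra.norm F (algebraMap F (AdjoinRoot (X ^ 3 - C a)) x - AdjoinRoot.root (X ^ 3 - C a))
      = x ^ 3 - a := by
  have hm : (X ^ 3 - C a : F[X]).Monic := monic_X_pow_sub_C a (by norm_num)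
  have h0 := hm.ne_zero
  let pb := AdjoinRoot.powerBasis h0
  have h1 : minpoly F pb.gen = X ^ 3 - C a := by
    rw [AdjoinRoot.minpoly_powerBasis_gen_of_monic hm]
  have h2 := charpoly_leftMulMatrix pb
  have h3 : pb.gen = AdjoinRoot.root (X ^ 3 - C a) := AdjoinRoot.powerBasis_gen h0
  rw [h1, h3] at h2
  rw [Algebra.norm_eq_matrix_det pb.basis, map_sub, AlgHom.commutes]
  have h4 := Matrix.eval_charpoly (Algebra.leftMulMatrix pb.basis (AdjoinRoot.root (X ^ 3 - C a))) x
  rw [h2] at h4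
  simp only [eval_sub, eval_pow, eval_X, eval_C] at h4
  rw [h4]
  rfl

theorem norm_lin_aux (F : Type*) [Field F] (a x y : F) :
    Algebra.norm F (algebraMap F (AdjoinRoot (X ^ 3 - C a)) x
      + algebraMap F (AdjoinRoot (X ^ 3 - C a)) y * AdjoinRoot.root (X ^ 3 - C a))
      = x ^ 3 + a * y ^ 3 := by
  have hm : (X ^ 3 - C a : F[X]).Monic := monic_X_pow_sub_C a (by norm_num)
  have h0 := hm.ne_zero
  have hc (z : F) : Algebra.norm F (algebraMap F (AdjoinRoot (X ^ 3 - C a)) z) = z ^ 3 := by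
    rw [Algebra.norm_algebraMap_of_basis (AdjoinRoot.powerBasis h0).basis, Fintype.card_fin,
      AdjoinRoot.powerBasis_dim, natDegree_X_pow_sub_C]
  by_cases hy : y = 0
  · subst hy
    rw [map_zero, zero_mul, add_zero, hc]
    ring
  · have : algebraMap F (AdjoinRoot (X ^ 3 - C a)) x
      + algebraMap F (AdjoinRoot (X ^ 3 - C a)) y * AdjoinRoot.root (X ^ 3 - C a)
      = algebraMap F (AdjoinRoot (X ^ 3 - C a)) (-y) *
        (algebraMap F (AdjoinRoot (X ^ 3 - C a)) (-x / y) - AdjoinRoot.root (X ^ 3 - C a)) := by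
      rw [mul_sub, ← map_mul, show -y * (-x / y) = x by field_simp, map_neg]
      ring
    rw [this, map_mul, hc, norm_sub_root_aux]
    field_simp
    ring

/-- If `a` is not a cube in a field `F`, `b ≠ 0`, `f = g³` is a nonzero cube,
and the cubic surface `a·u³ + b·v³ + a·b·w³ + f·t³ = 0` has a nontrivial
`F`-point, then `b` is a norm from the pure cubic extension `L = F[X]/(X³ - a)`. -/
theorem norm_of_point_on_cubic_surface_cube_coeff (F : Type*) [Field F] (a b f : F)
    (ha : ¬∃ c : F, c ^ 3 = a) (hb : b ≠ 0)
    (g : F) (hg : g ≠ 0) (hf : f = g ^ 3)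
    (u v w t : F) (hnt : ¬(u = 0 ∧ v = 0 ∧ w = 0 ∧ t = 0))
    (heq : a * u ^ 3 + b * v ^ 3 + a * b * w ^ 3 + f * t ^ 3 = 0) :
    ∃ β : AdjoinRoot (X ^ 3 - C a), Algebra.norm F β = b := by
  subst hf
  have key : ∀ x y : F, x ^ 3 + a * y ^ 3 = 0 → x = 0 ∧ y = 0 := by
    intro x y h
    have hy : y = 0 := by
      by_contra hy
      refine ha ⟨-x / y, ?_⟩
      field_simp
      linear_combination -h
    subst hy
    simpa using h
  have hn : v ^ 3 + a * w ^ 3 ≠ 0 := by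
    intro h
    obtain ⟨hv, hw⟩ := key _ _ h
    obtain ⟨h1, h2⟩ := key (g * t) u (by linear_combination heq - b * h)
    exact hnt ⟨h2, hv, hw, (mul_eq_zero.1 h1).resolve_left hg⟩
  let φ := algebraMap F (AdjoinRoot (X ^ 3 - C a))
  let r := AdjoinRoot.root (X ^ 3 - C a)
  have hr : r ^ 3 = φ a := by
    have := AdjoinRoot.eval₂_root (X ^ 3 - C a)
    simp only [eval₂_sub, eval₂_pow, eval₂_X, eval₂_C] at this
    exact sub_eq_zero.1 this
  let γ := φ (v ^ 3 + a * w ^ 3)⁻¹ * (φ v ^ 2 - φ v * φ w * r + φ w ^ 2 * r ^ 2)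
  have h1 : (φ v + φ w * r) * γ = 1 := by
    have h2 : (φ v + φ w * r) * γ = φ (v ^ 3 + a * w ^ 3)⁻¹ * φ (v ^ 3 + a * w ^ 3) := by
      simp only [γ, map_add, map_mul, map_pow, ← hr]
      ring
    rw [h2, ← map_mul, inv_mul_cancel₀ hn, map_one]
  have h3 := congrArg (Algebra.norm F) h1
  rw [map_mul, map_one, norm_lin_aux] at h3
  refine ⟨(φ (-(g * t)) + φ (-u) * r) * γ, ?_⟩
  rw [map_mul, norm_lin_aux]
  linear_combination b * h3 - Algebra.norm F γ * heq
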